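/- Let 1 < β < 2 and let M ≥ 2 be an integer. Then the circulant matrix r(G_β) is real symmetric positive definite, and every eigenvalue λ of r(G_β) satisfies 0 < λ < 2·ĝ₀^{(β)}. -/

import Mathlib

/-- Fractional centered difference coefficients `ĝ_k^{(β)}`. -/
noncomputable def ghat (β : ℝ) (k : ℤ) : ℝ :=
  (-1 : ℝ) ^ k * Real.Gamma (β + 1) /
    (Real.Gamma (β / 2 - k + 1) * Real.Gamma (β / 2 + k + 1))

/-- The `(M−1)×(M−1)` symmetric Toeplitz matrix `G_β`. -/
noncomputable def Gmat (β : ℝ) (M : ℕ) : Matrix (Fin (M - 1)) (Fin (M - 1)) ℝ :=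
  Matrix.of fun i j => ghat β ((i : ℤ) - (j : ℤ))

/-- First column of the circulant approximation `r(G_β)`. -/
noncomputable def rcol (β : ℝ) (M : ℕ) (k : ℕ) : ℝ :=
  if k = 0 then ghat β 0 else ghat β k + ghat β ((k : ℤ) - ((M : ℤ) - 1))

/-- The `(M−1)×(M−1)` circulant matrix `r(G_β)`. -/
noncomputable def circG (β : ℝ) (M : ℕ) : Matrix (Fin (M - 1)) (Fin (M - 1)) ℝ :=
  Matrix.of fun i j => rcol β M ((((i : ℤ) - (j : ℤ)) % ((M : ℤ) - 1)).toNat)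

/-- The constant `c_*^{(β)} = (2/β) r_β`. -/
noncomputable def cstar (β : ℝ) : ℝ :=
  (2 / β) * (Real.exp (-2) * ((4 - β) * (2 - β) * β) / ((6 + β) * (4 + β) * (2 + β)) *
    (Real.Gamma (β + 1) / (Real.Gamma (β / 2 + 1)) ^ 2) * (3 + β / 2) ^ (β + 1))

/-- Grünwald coefficients `g_k^{(γ)}`. -/
noncomputable def gcoef (γ : ℝ) : ℕ → ℝ
  | 0 => 1
  | (k + 1) => (1 - (γ + 1) / (k + 1)) * gcoef γ k

/-- Weighted and shifted Grünwald coefficients `λ_k^{(γ)}`. -/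
noncomputable def lamc (γ : ℝ) : ℕ → ℝ
  | 0 => 1 + γ / 2
  | (k + 1) => (1 + γ / 2) * gcoef γ (k + 1) - (γ / 2) * gcoef γ k

lemma ghat_neg (β : ℝ) (k : ℤ) : ghat β (-k) = ghat β k := by
  unfold ghat
  rw [zpow_neg, ← inv_zpow]
  have : (-1 : ℝ)⁻¹ = -1 := by norm_num
  rw [this]
  push_cast
  rw [mul_comm (Real.Gamma (β / 2 - -(k : ℝ) + 1))]
  ring_nf

lemma ghat_zero_pos (β : ℝ) (hβ1 : 1 < β) : 0 < ghat β 0 := by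
  unfold ghat
  have h1 : 0 < Real.Gamma (β + 1) := Real.Gamma_pos_of_pos (by linarith)
  have h2 : 0 < Real.Gamma (β / 2 + 1) := Real.Gamma_pos_of_pos (by linarith)
  simp only [zpow_zero, Int.cast_zero, sub_zero, add_zero, one_mul]
  positivity

lemma ghat_rec (β : ℝ) (hβ1 : 1 < β) (hβ2 : β < 2) (k : ℕ) :
    ((k : ℝ) + 1 + β / 2) * ghat β ((k + 1 : ℕ) : ℤ) = (k - β / 2) * ghat β (k : ℤ) := by
  have hk : β / 2 - (k : ℝ) ≠ 0 := by
    rcases k with _ | k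
    · push_cast; linarith
    · push_cast
      have : (0 : ℝ) ≤ k := Nat.cast_nonneg k
      intro h; linarith
  have hk2 : β / 2 + (k : ℝ) + 1 ≠ 0 := by positivity
  have e1 : Real.Gamma (β / 2 - k + 1) = (β / 2 - k) * Real.Gamma (β / 2 - k) :=
    Real.Gamma_add_one hk
  have e2 : Real.Gamma (β / 2 + k + 1 + 1) = (β / 2 + k + 1) * Real.Gamma (β / 2 + k + 1) :=
    Real.Gamma_add_one hk2
  unfold ghat
  push_cast
  have a1 : β / 2 - ((k : ℝ) + 1) + 1 = β / 2 - k := by ring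
  have a2 : β / 2 + ((k : ℝ) + 1) + 1 = β / 2 + k + 1 + 1 := by ring
  rw [a1, a2, e1, e2, zpow_add_one₀ (by norm_num)]
  have h3 : Real.Gamma (β / 2 + k + 1) ≠ 0 := (Real.Gamma_pos_of_pos (by positivity)).ne'
  have h4 : Real.Gamma (β / 2 - k) ≠ 0 := by
    apply Real.Gamma_ne_zero
    intro m h
    have h5 : β = 2 * ((k : ℤ) - m : ℤ) := by push_cast; linarith
    have h6 : (0 : ℤ) < (k : ℤ) - m := by
      have : (0 : ℝ) < (((k : ℤ) - m : ℤ) : ℝ) := by linarith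
      exact_mod_cast this
    have h7 : (1 : ℝ) ≤ (((k : ℤ) - m : ℤ) : ℝ) := by exact_mod_cast h6
    linarith
  generalize Real.Gamma (β / 2 - k) = x at *
  generalize Real.Gamma (β / 2 + k + 1) = y at *
  generalize Real.Gamma (β + 1) = z at *
  generalize (-1 : ℝ) ^ (k : ℤ) = w at *
  rw [mul_div_assoc', mul_div_assoc', div_eq_div_iff (by positivity) (by positivity)]
  ring

lemma ghat_succ_neg (β : ℝ) (hβ1 : 1 < β) (hβ2 : β < 2) (k : ℕ) :
    ghat β ((k + 1 : ℕ) : ℤ) < 0 := by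
  induction k with
  | zero =>
    have h := ghat_rec β hβ1 hβ2 0
    have h0 := ghat_zero_pos β hβ1
    push_cast at h ⊢
    by_contra! hc
    nlinarith [mul_nonneg (by linarith : 0 ≤ (0 : ℝ) + 1 + β / 2) hc,
      mul_pos (by linarith : 0 < β / 2) h0]
  | succ k ih =>
    have h := ghat_rec β hβ1 hβ2 (k + 1)
    by_contra! hc
    have hk : (0 : ℝ) ≤ k := Nat.cast_nonneg k
    have p1 : 0 ≤ (((k + 1 : ℕ) : ℝ) + 1 + β / 2) := by positivity
    have p2 : 0 < (((k + 1 : ℕ) : ℝ) - β / 2) := by push_cast; linarith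
    have := mul_nonneg p1 hc
    have := mul_neg_of_pos_of_neg p2 ih
    linarith

lemma ghat_sum (β : ℝ) (hβ1 : 1 < β) (hβ2 : β < 2) (n : ℕ) :
    β / 2 * (ghat β 0 + 2 * ∑ k ∈ Finset.range n, ghat β ((k + 1 : ℕ) : ℤ)) =
      -(((n : ℝ) + 1 + β / 2) * ghat β ((n + 1 : ℕ) : ℤ)) := by
  induction n with
  | zero =>
    rw [ghat_rec β hβ1 hβ2 0]
    simp
  | succ n ih =>
    rw [ghat_rec β hβ1 hβ2 (n + 1), Finset.sum_range_succ]
    push_cast at ih ⊢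
    linarith

lemma ghat_sum_pos (β : ℝ) (hβ1 : 1 < β) (hβ2 : β < 2) (n : ℕ) :
    0 < ghat β 0 + 2 * ∑ k ∈ Finset.range n, ghat β ((k + 1 : ℕ) : ℤ) := by
  have h := ghat_sum β hβ1 hβ2 n
  have h1 := ghat_succ_neg β hβ1 hβ2 n
  have h2 : 0 < -(((n : ℝ) + 1 + β / 2) * ghat β ((n + 1 : ℕ) : ℤ)) := by
    rw [neg_pos]
    exact mul_neg_of_pos_of_neg (by positivity) h1
  rw [← h] at h2
  exact pos_of_mul_pos_right h2 (by linarith)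

lemma circG_entry (β : ℝ) (m : ℕ) (i j : Fin (m + 1)) :
    circG β (m + 2) i j = rcol β (m + 2) ((i - j : Fin (m + 1)) : ℕ) := by
  have : ((((i : ℕ) : ℤ) - ((j : ℕ) : ℤ)) % (((m + 2 : ℕ) : ℤ) - 1)).toNat
      = ((i - j : Fin (m + 1)) : ℕ) := by
    have hj := j.2
    rw [Fin.sub_def]
    simp only
    have e : (((m + 2 : ℕ) : ℤ) - 1) = ((m + 1 : ℕ) : ℤ) := by push_cast; ring
    rw [e]
    have : ((i : ℕ) : ℤ) - ((j : ℕ) : ℤ)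
        = ((m + 1 - (j : ℕ) + (i : ℕ) : ℕ) : ℤ) - ((m + 1 : ℕ) : ℤ) := by omega
    rw [this, Int.sub_emod_right, ← Int.natCast_mod, Int.toNat_natCast]
  show rcol β (m + 2) _ = _
  rw [← this]

lemma rcol_succ (β : ℝ) (m k : ℕ) (hk : k < m) : rcol β (m + 2) (k + 1) =
    ghat β ((k + 1 : ℕ) : ℤ) + ghat β ((m - 1 - k + 1 : ℕ) : ℤ) := by
  unfold rcol
  rw [if_neg (by omega)]
  congr 1
  rw [← ghat_neg]
  congr 1
  omega

lemma row_sum (β : ℝ) (hβ1 : 1 < β) (hβ2 : β < 2) (m : ℕ) (i : Fin (m + 1)) :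
    ∑ j ∈ Finset.univ.erase i, ‖circG β (m + 2) i j‖ < ghat β 0 := by
  have hg := ghat_zero_pos β hβ1
  have h1 : ∑ j, ‖circG β (m + 2) i j‖ = ∑ k : Fin (m + 1), ‖rcol β (m + 2) (k : ℕ)‖ := by
    rw [← Equiv.sum_comp (Equiv.subLeft i) (fun k : Fin (m + 1) => ‖rcol β (m + 2) (k : ℕ)‖)]
    exact Finset.sum_congr rfl fun j _ => by rw [circG_entry]; rfl
  have h2 : ∑ k : Fin (m + 1), ‖rcol β (m + 2) (k : ℕ)‖
      = ghat β 0 - 2 * ∑ k ∈ Finset.range m, ghat β ((k + 1 : ℕ) : ℤ) := by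
    rw [Fin.sum_univ_eq_sum_range (fun k => ‖rcol β (m + 2) k‖), Finset.sum_range_succ']
    have e0 : ‖rcol β (m + 2) 0‖ = ghat β 0 := by
      simp [rcol, abs_of_pos hg]
    have e1 : ∑ k ∈ Finset.range m, ‖rcol β (m + 2) (k + 1)‖ =
        ∑ k ∈ Finset.range m,
          (-ghat β ((k + 1 : ℕ) : ℤ) + -ghat β ((m - 1 - k + 1 : ℕ) : ℤ)) := by
      refine Finset.sum_congr rfl fun k hk => ?_
      rw [rcol_succ β m k (Finset.mem_range.1 hk), Real.norm_of_nonpos]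
      · ring
      · linarith [ghat_succ_neg β hβ1 hβ2 k, ghat_succ_neg β hβ1 hβ2 (m - 1 - k)]
    rw [e0, e1, Finset.sum_add_distrib,
      Finset.sum_range_reflect (fun k => -ghat β ((k + 1 : ℕ) : ℤ)) m, Finset.sum_neg_distrib]
    ring
  have h3 : ‖circG β (m + 2) i i‖ = ghat β 0 := by
    rw [circG_entry]; simp [rcol, abs_of_pos hg]
  have h4 := Finset.add_sum_erase Finset.univ (fun j => ‖circG β (m + 2) i j‖)
    (Finset.mem_univ i)
  have h5 := ghat_sum_pos β hβ1 hβ2 m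
  have h6 := h4.trans (h1.trans h2)
  have key : ∀ a x s g : ℝ, a = g → a + x = g - 2 * s → 0 < g + 2 * s → x < g := by
    intros; linarith
  exact key _ _ _ _ h3 h6 h5

lemma circG_symm (β : ℝ) (m : ℕ) : (circG β (m + 2)).IsSymm := by
  refine Matrix.IsSymm.ext fun i j => ?_
  change Fin (m + 1) at i j
  rw [circG_entry, circG_entry]
  by_cases h : i = j
  · rw [h]
  have h0 : ((i - j : Fin (m + 1)) : ℕ) ≠ 0 := by
    intro h1
    exact h (sub_eq_zero.1 (Fin.ext h1))
  have h1 : ((j - i : Fin (m + 1)) : ℕ) = m + 1 - ((i - j : Fin (m + 1)) : ℕ) := by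
    have hi := i.2
    have hj := j.2
    have hn : (i : ℕ) ≠ j := fun h' => h (Fin.ext h')
    rcases lt_or_gt_of_ne hn with h' | h'
    · rw [Fin.sub_val_of_le (show i ≤ j from h'.le), Fin.coe_sub_iff_lt.2 h']
      omega
    · rw [Fin.sub_val_of_le (show j ≤ i from h'.le), Fin.coe_sub_iff_lt.2 h']
      omega
  have hlt := (i - j : Fin (m + 1)).2
  obtain ⟨k, hk⟩ := Nat.exists_eq_succ_of_ne_zero h0
  rw [h1, hk]
  have hkm : k < m := by omega
  have e : m + 1 - k.succ = (m - 1 - k) + 1 := by omega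
  rw [e, Nat.succ_eq_add_one, rcol_succ _ _ _ hkm, rcol_succ _ _ _ (by omega), add_comm]
  congr 3
  omega

lemma eig_bound (β : ℝ) (hβ1 : 1 < β) (hβ2 : β < 2) (m : ℕ)
    (lam : ℝ) (v : Fin (m + 1) → ℝ) (hv : v ≠ 0)
    (h : (circG β (m + 2)).mulVec v = lam • v) : 0 < lam ∧ lam < 2 * ghat β 0 := by
  have he : Module.End.HasEigenvalue (Matrix.toLin' (circG β (m + 2))) lam := by
    refine Module.End.hasEigenvalue_of_hasEigenvector (x := v) ⟨?_, hv⟩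
    rw [Module.End.mem_eigenspace_iff]
    simpa using h
  obtain ⟨k, hk⟩ := eigenvalue_mem_ball he
  have hr := row_sum β hβ1 hβ2 m k
  have hd : circG β (m + 2) k k = ghat β 0 := by
    rw [circG_entry β m k k]; simp [rcol]
  rw [Metric.mem_closedBall, Real.dist_eq, hd] at hk
  have := abs_lt.1 (lt_of_le_of_lt hk hr)
  constructor <;> linarith [this.1, this.2]

/-- the circulant matrix `r(G_β)` is real symmetric positive definite and
all its eigenvalues lie in `(0, 2 ĝ₀^{(β)})`. -/
theorem stmt3 (β : ℝ) (hβ1 : 1 < β) (hβ2 : β < 2) (M : ℕ) (hM : 2 ≤ M) :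
    (circG β M).IsSymm ∧ (circG β M).PosDef ∧
    ∀ (lam : ℝ) (v : Fin (M - 1) → ℝ), v ≠ 0 → (circG β M).mulVec v = lam • v →
      0 < lam ∧ lam < 2 * ghat β 0 := by
  obtain ⟨m, rfl⟩ := Nat.exists_eq_add_of_le' hM
  have hs := circG_symm β m
  have hE := eig_bound β hβ1 hβ2 m
  refine ⟨hs, ?_, hE⟩
  have hH : (circG β (m + 2)).IsHermitian := by
    rw [Matrix.IsHermitian, Matrix.conjTranspose_eq_transpose_of_trivial]
    exact hs
  rw [hH.posDef_iff_eigenvalues_pos]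
  intro i
  refine (hE _ (hH.eigenvectorBasis i).ofLp ?_ (hH.mulVec_eigenvectorBasis i)).1
  intro h0
  exact hH.eigenvectorBasis.toBasis.ne_zero i (by
    rw [OrthonormalBasis.coe_toBasis]
    ext j
    exact congrFun h0 j)
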